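/- For every integer d ≥ 2, the language L_(d) = {aⁿ b^{kn} : k ∈ [d], n ≥ 0} over the alphabet {a, b} belongs to DCFL[d] but does not belong to DCFL[d−1]. -/

import Mathlib

/-!
Formalization of one-way deterministic pushdown automata (1dpda) following
Yamakami, "Intersection and Union Hierarchies of Deterministic Context-Free
Languages and Pumping Lemmas".
-/

namespace DCFLFormal

/-- Tape symbols: the left endmarker ¢, the right endmarker $, and input symbols. -/
inductive TSym (α : Type) : Type
  | lend : TSym α
  | rend : TSym α
  | ch : α → TSym α

/-- A one-way deterministic pushdown automaton (1dpda).  `δ q (some t) a` is the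
transition reading the tape symbol `t` with top stack symbol `a`; `δ q none a`
is the ε-transition.  The value `some (p, w)` means: change state to `p` and
replace the topmost stack symbol by the string `w`. -/
structure DPDA (Q α Γ : Type) where
  δ : Q → Option (TSym α) → Γ → Option (Q × List Γ)
  q0 : Q
  Z0 : Γ
  Acc : Set Q
  Rej : Set Q

/-- A configuration: current state, remaining (unread) tape, and stack content
(topmost symbol first, the bottom marker last). -/
structure Cfg (Q α Γ : Type) where
  st : Q
  inp : List (TSym α)
  stk : List Γ

namespace DPDA

variable {Q α Γ : Type}

/-- Halting (accepting or rejecting) states. -/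
def IsHalting (M : DPDA Q α Γ) (q : Q) : Prop := q ∈ M.Acc ∨ q ∈ M.Rej

/-- One step of the machine: an ε-move if one is defined, otherwise read the
next tape symbol; the head moves right exactly when a tape symbol is read. -/
def step (M : DPDA Q α Γ) (c : Cfg Q α Γ) : Option (Cfg Q α Γ) :=
  match c.stk with
  | [] => none
  | a :: s =>
    match M.δ c.st none a with
    | some (p, w) => some ⟨p, c.inp, w ++ s⟩
    | none =>
      match c.inp with
      | [] => none
      | t :: rest =>
        match M.δ c.st (some t) a with
        | some (p, w) => some ⟨p, rest, w ++ s⟩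
        | none => none

/-- Iterated steps. -/
def stepN (M : DPDA Q α Γ) : ℕ → Cfg Q α Γ → Option (Cfg Q α Γ)
  | 0, c => some c
  | n + 1, c => (M.step c).bind (M.stepN n)

/-- The tape holding ¢ x $. -/
def tape (x : List α) : List (TSym α) :=
  TSym.lend :: x.map TSym.ch ++ [TSym.rend]

/-- The initial configuration on input `x`. -/
def init (M : DPDA Q α Γ) (x : List α) : Cfg Q α Γ := ⟨M.q0, tape x, [M.Z0]⟩

/-- `M` accepts `x`: the computation reaches an accepting state. -/
def Accepts (M : DPDA Q α Γ) (x : List α) : Prop :=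
  ∃ n c, M.stepN n (M.init x) = some c ∧ c.st ∈ M.Acc

/-- `M` rejects `x`: the computation reaches a rejecting state. -/
def Rejects (M : DPDA Q α Γ) (x : List α) : Prop :=
  ∃ n c, M.stepN n (M.init x) = some c ∧ c.st ∈ M.Rej

/-- `M` halts (in an accepting or rejecting state) on every input. -/
def HaltsOnAll (M : DPDA Q α Γ) : Prop :=
  ∀ x : List α, ∃ n c, M.stepN n (M.init x) = some c ∧ M.IsHalting c.st

/-- The language recognized by `M`. -/
def lang (M : DPDA Q α Γ) : Set (List α) := {x | M.Accepts x}

/-- Well-formedness of a 1dpda: accepting and rejecting states are disjoint,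
halting states have no outgoing transitions, for every non-halting state,
stack symbol and (non-empty) tape symbol exactly one of the symbol- and the
ε-transition is defined, and the bottom marker Z₀ is never removed. -/
def Valid (M : DPDA Q α Γ) : Prop :=
  (∀ q, q ∈ M.Acc → q ∉ M.Rej) ∧
  (∀ q, M.IsHalting q → ∀ σ a, M.δ q σ a = none) ∧
  (∀ q, ¬ M.IsHalting q → ∀ σ a, ((M.δ q (some σ) a).isSome ↔ M.δ q none a = none)) ∧
  (∀ q σ p w, M.δ q σ M.Z0 = some (p, w) → w ≠ [])

end DPDA

/-- A language is deterministic context-free if it is recognized by some 1dpda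
(with finitely many states and stack symbols) that halts on all inputs. -/
def IsDCFL {α : Type} (L : Set (List α)) : Prop :=
  ∃ (Q Γ : Type) (_ : Fintype Q) (_ : Fintype Γ) (M : DPDA Q α Γ),
    M.Valid ∧ M.HaltsOnAll ∧ L = M.lang

/-- `DCFL(d)`: intersections of `d` dcf languages. -/
def DCFLInter {α : Type} (d : ℕ) (L : Set (List α)) : Prop :=
  ∃ f : Fin d → Set (List α), (∀ i, IsDCFL (f i)) ∧ L = ⋂ i, f i

/-- `DCFL[d]`: unions of `d` dcf languages. -/
def DCFLUnion {α : Type} (d : ℕ) (L : Set (List α)) : Prop :=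
  ∃ f : Fin d → Set (List α), (∀ i, IsDCFL (f i)) ∧ L = ⋃ i, f i

/-- `rep x i` is the string `x` repeated `i` times. -/
def rep {α : Type} (x : List α) (i : ℕ) : List α := (List.replicate i x).flatten

/-- `(x, y)` is an iterative pair of the string `u ++ x ++ v ++ y ++ z` for `L`. -/
def IterPair {α : Type} (L : Set (List α)) (u x v y z : List α) : Prop :=
  1 ≤ (x ++ y).length ∧ ∀ i : ℕ, u ++ rep x i ++ v ++ rep y i ++ z ∈ L

/-- A nondegenerate iterative pair: either `{u xⁱ v yʲ z ∈ L : j ≥ 0}` is finite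
for each `i`, or `{u xⁱ v yʲ z ∈ L : i ≥ 0}` is finite for each `j`. -/
def NonDegIterPair {α : Type} (L : Set (List α)) (u x v y z : List α) : Prop :=
  IterPair L u x v y z ∧
  ((∀ i : ℕ, {s | s ∈ L ∧ ∃ j : ℕ, s = u ++ rep x i ++ v ++ rep y j ++ z}.Finite) ∨
   (∀ j : ℕ, {s | s ∈ L ∧ ∃ i : ℕ, s = u ++ rep x i ++ v ++ rep y j ++ z}.Finite))


/-- The language `L_(d) = {aⁿ b^{kn} : k ∈ [d], n ≥ 0}` over the alphabet `Bool`
(where `false` is `a` and `true` is `b`). -/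
def Lkn (d : ℕ) : Set (List Bool) :=
  {s | ∃ n k : ℕ, 1 ≤ k ∧ k ≤ d ∧
    s = List.replicate n false ++ List.replicate (k * n) true}

namespace DPDA

variable {Q α Γ : Type} {M : DPDA Q α Γ}

/-! ### Computations of a pushdown automaton -/

/-- `M.Reaches c c'`: the computation from `c` passes through `c'`. -/
def Reaches (M : DPDA Q α Γ) (c c' : Cfg Q α Γ) : Prop := ∃ k, M.stepN k c = some c'

/-- The computation from `c` passes through an accepting state. -/
def AcceptsFrom (M : DPDA Q α Γ) (c : Cfg Q α Γ) : Prop := ∃ c', M.Reaches c c' ∧ c'.st ∈ M.Acc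

theorem mem_lang_iff {x : List α} : x ∈ M.lang ↔ M.AcceptsFrom (M.init x) :=
  ⟨fun ⟨k, c, h, hc⟩ => ⟨c, ⟨k, h⟩, hc⟩, fun ⟨c, ⟨k, h⟩, hc⟩ => ⟨k, c, h, hc⟩⟩

theorem stepN_add (k l : ℕ) (c : Cfg Q α Γ) :
    M.stepN (k + l) c = (M.stepN k c).bind (M.stepN l) := by
  induction k generalizing c with
  | zero => simp [stepN]
  | succ k ih =>
    rw [Nat.add_right_comm]
    simp only [stepN]
    cases M.step c with
    | none => rfl
    | some c' => simpa using ih c'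

theorem Reaches.refl (c : Cfg Q α Γ) : M.Reaches c c := ⟨0, rfl⟩

theorem Reaches.head {c c' c'' : Cfg Q α Γ} (h : M.step c = some c') (h' : M.Reaches c' c'') :
    M.Reaches c c'' := by
  obtain ⟨k, hk⟩ := h'
  exact ⟨k + 1, by simp [stepN, h, hk]⟩

theorem Reaches.trans {c c' c'' : Cfg Q α Γ} (h : M.Reaches c c') (h' : M.Reaches c' c'') :
    M.Reaches c c'' := by
  obtain ⟨k, hk⟩ := h
  obtain ⟨l, hl⟩ := h'
  exact ⟨k + l, by simp [stepN_add, hk, hl]⟩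

@[elab_as_elim]
theorem Reaches.induction {c' : Cfg Q α Γ} {P : ∀ c, M.Reaches c c' → Prop}
    (refl : P c' (.refl c'))
    (head : ∀ c c₁ (h : M.step c = some c₁) (h' : M.Reaches c₁ c'), P c₁ h' → P c (h'.head h))
    {c : Cfg Q α Γ} (h : M.Reaches c c') : P c h := by
  obtain ⟨k, hk⟩ := id h
  induction k generalizing c with
  | zero =>
    obtain rfl : c = c' := by simpa [stepN] using hk
    exact refl
  | succ k ih =>
    obtain ⟨c₁, h₁, h₂⟩ := Option.bind_eq_some_iff.1 hk
    exact head c c₁ h₁ ⟨k, h₂⟩ (ih ⟨k, h₂⟩ h₂)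

theorem Reaches.total {c c₁ c₂ : Cfg Q α Γ} (h₁ : M.Reaches c c₁) (h₂ : M.Reaches c c₂) :
    M.Reaches c₁ c₂ ∨ M.Reaches c₂ c₁ := by
  obtain ⟨k, hk⟩ := h₁
  obtain ⟨l, hl⟩ := h₂
  rcases le_total k l with h | h
  · obtain ⟨m, rfl⟩ := Nat.exists_eq_add_of_le h
    exact .inl ⟨m, by simpa [stepN_add, hk] using hl⟩
  · obtain ⟨m, rfl⟩ := Nat.exists_eq_add_of_le h
    exact .inr ⟨m, by simpa [stepN_add, hl] using hk⟩

theorem Reaches.eq_of_step_eq_none {c c' : Cfg Q α Γ} (h : M.Reaches c c')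
    (hc : M.step c = none) : c = c' := by
  obtain ⟨_ | k, hk⟩ := h
  · simpa [stepN] using hk
  · simp [stepN, hc] at hk

theorem Reaches.unique {c c₁ c₂ : Cfg Q α Γ} (h₁ : M.Reaches c c₁) (h₂ : M.Reaches c c₂)
    (n₁ : M.step c₁ = none) (n₂ : M.step c₂ = none) : c₁ = c₂ :=
  (h₁.total h₂).elim (·.eq_of_step_eq_none n₁) fun h => (h.eq_of_step_eq_none n₂).symm

theorem Reaches.acceptsFrom {c c' : Cfg Q α Γ} (h : M.Reaches c c') (h' : M.AcceptsFrom c') :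
    M.AcceptsFrom c :=
  let ⟨d, hd, ha⟩ := h'
  ⟨d, h.trans hd, ha⟩

theorem step_nil (q : Q) (u : List (TSym α)) : M.step ⟨q, u, []⟩ = none := rfl

/-- A step either is an ε-move or reads one tape symbol. -/
theorem step_eq_some_iff {c c' : Cfg Q α Γ} :
    M.step c = some c' ↔ ∃ a s w, c.stk = a :: s ∧ c'.stk = w ++ s ∧
      ((M.δ c.st none a = some (c'.st, w) ∧ c'.inp = c.inp) ∨
        (M.δ c.st none a = none ∧ ∃ t, c.inp = t :: c'.inp ∧
          M.δ c.st (some t) a = some (c'.st, w))) := by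
  obtain ⟨q, u, γ⟩ := c
  obtain ⟨q', u', γ'⟩ := c'
  rcases γ with _ | ⟨a, s⟩
  · simp [step]
  rcases h : M.δ q none a with _ | ⟨p, w⟩
  · rcases u with _ | ⟨t, u⟩
    · simp [step, h]
    · rcases h' : M.δ q (some t) a with _ | ⟨p, w⟩
      · simp [step, h, h']
      · simp [step, h, h']
        grind
  · simp [step, h]
    grind

theorem step_append {q q' : Q} {u u' : List (TSym α)} {γ γ' : List Γ}
    (h : M.step ⟨q, u, γ⟩ = some ⟨q', u', γ'⟩) (r : List (TSym α)) (β : List Γ) :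
    M.step ⟨q, u ++ r, γ ++ β⟩ = some ⟨q', u' ++ r, γ' ++ β⟩ := by
  rw [step_eq_some_iff] at h ⊢
  obtain ⟨a, s, w, h₁, h₂, h₃⟩ := h
  refine ⟨a, s ++ β, w, by simp_all, by simp_all, ?_⟩
  rcases h₃ with h₃ | ⟨h₃, t, h₄, h₅⟩
  · left; simp_all
  · right; simp_all

/-- Unread input and untouched stack symbols may be added to a computation. -/
theorem Reaches.append {c : Cfg Q α Γ} {q' : Q} {u' : List (TSym α)} {γ' : List Γ}
    (h : M.Reaches c ⟨q', u', γ'⟩) (r : List (TSym α)) (β : List Γ) :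
    M.Reaches ⟨c.st, c.inp ++ r, c.stk ++ β⟩ ⟨q', u' ++ r, γ' ++ β⟩ := by
  induction h using Reaches.induction with
  | refl => exact .refl _
  | head c c₁ h _ ih => exact .head (step_append h r β) ih

/-- The input left over is a suffix of the input, and is irrelevant to the computation. -/
theorem Reaches.exists_inp {c c' : Cfg Q α Γ} (h : M.Reaches c c') :
    ∃ w, c.inp = w ++ c'.inp ∧ M.Reaches ⟨c.st, w, c.stk⟩ ⟨c'.st, [], c'.stk⟩ := by
  induction h using Reaches.induction with
  | refl => exact ⟨[], rfl, .refl _⟩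
  | head c c₁ h _ ih =>
    obtain ⟨w, hw, ih⟩ := ih
    obtain ⟨a, s, v, h₁, h₂, ⟨h₃, h₄⟩ | ⟨h₃, t, h₄, h₅⟩⟩ := step_eq_some_iff.1 h
    · refine ⟨w, by rw [← hw, h₄], .head ?_ ih⟩
      exact step_eq_some_iff.2 ⟨a, s, v, h₁, h₂, .inl ⟨h₃, rfl⟩⟩
    · refine ⟨t :: w, by rw [h₄, hw]; rfl, .head ?_ ih⟩
      exact step_eq_some_iff.2 ⟨a, s, v, h₁, h₂, .inr ⟨h₃, t, rfl, h₅⟩⟩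

/-- A computation that reads `u ++ v` passes through a configuration where `u` has been read. -/
theorem Reaches.exists_append {c c' : Cfg Q α Γ} (h : M.Reaches c c') {u v : List (TSym α)}
    (hc : c.inp = u ++ v) (hv : c'.inp.length ≤ v.length) :
    ∃ q γ, M.Reaches ⟨c.st, u, c.stk⟩ ⟨q, [], γ⟩ := by
  induction h using Reaches.induction generalizing u with
  | refl =>
    obtain rfl : u = [] := by
      have := congrArg List.length hc
      simp at this
      exact List.length_eq_zero_iff.1 (by omega)
    exact ⟨_, _, .refl _⟩
  | head c c₁ h _ ih =>
    rcases u with _ | ⟨t, u⟩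
    · exact ⟨_, _, .refl _⟩
    obtain ⟨a, s, w, h₁, h₂, ⟨h₃, h₄⟩ | ⟨h₃, t', h₄, h₅⟩⟩ := step_eq_some_iff.1 h
    · obtain ⟨q, γ, ih⟩ := ih (h₄.trans hc)
      refine ⟨q, γ, .head ?_ ih⟩
      exact step_eq_some_iff.2 ⟨a, s, w, h₁, h₂, .inl ⟨h₃, rfl⟩⟩
    · rw [hc, List.cons_append, List.cons.injEq] at h₄
      obtain ⟨rfl, h₄⟩ := h₄
      obtain ⟨q, γ, ih⟩ := ih h₄.symm
      refine ⟨q, γ, .head ?_ ih⟩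
      exact step_eq_some_iff.2 ⟨a, s, w, h₁, h₂, .inr ⟨h₃, t, rfl, h₅⟩⟩

/-- A computation either never touches the lower part `β` of the stack, or passes through a
configuration whose stack is `β`. -/
theorem Reaches.untouched_or {c c' : Cfg Q α Γ} (h : M.Reaches c c') {ζ β : List Γ}
    (hc : c.stk = ζ ++ β) :
    (∃ ζ', c'.stk = ζ' ++ β ∧ M.Reaches ⟨c.st, c.inp, ζ⟩ ⟨c'.st, c'.inp, ζ'⟩) ∨
      ∃ s r, M.Reaches ⟨c.st, c.inp, ζ⟩ ⟨s, r, []⟩ ∧ M.Reaches ⟨s, r, β⟩ c' := by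
  induction h using Reaches.induction generalizing ζ with
  | refl => exact .inl ⟨ζ, hc, .refl _⟩
  | head c c₁ h hr ih =>
    rcases ζ with _ | ⟨a, ζ⟩
    · right
      refine ⟨c.st, c.inp, .refl _, .head ?_ hr⟩
      rw [← h]
      congr
      exact hc.symm
    · obtain ⟨a', s, w, h₁, h₂, h₃⟩ := step_eq_some_iff.1 h
      rw [h₁, List.cons_append, List.cons.injEq] at hc
      obtain ⟨rfl, rfl⟩ := hc
      have hs : M.step ⟨c.st, c.inp, a' :: ζ⟩ = some ⟨c₁.st, c₁.inp, w ++ ζ⟩ :=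
        step_eq_some_iff.2 ⟨a', ζ, w, rfl, rfl, h₃⟩
      rcases ih (ζ := w ++ ζ) (by simp [h₂]) with ⟨ζ', h₄, h₅⟩ | ⟨p, r, h₄, h₅⟩
      · exact .inl ⟨ζ', h₄, .head hs h₅⟩
      · exact .inr ⟨p, r, .head hs h₄, h₅⟩

/-- What can be observed of the stack `β` once at most the right endmarker is left to read. -/
def endType (M : DPDA Q α Γ) (β : List Γ) : Set (Q × Bool) :=
  {x | M.AcceptsFrom ⟨x.1, if x.2 then [TSym.rend] else [], β⟩}

theorem acceptsFrom_of_endType_eq {β β' : List Γ} (h : M.endType β = M.endType β') {q : Q}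
    {r w : List (TSym α)} (hr : w ++ r = [TSym.rend]) (ha : M.AcceptsFrom ⟨q, r, β⟩) :
    M.AcceptsFrom ⟨q, r, β'⟩ := by
  rcases List.append_eq_singleton_iff.1 hr with ⟨-, rfl⟩ | ⟨-, rfl⟩
  · have : (q, true) ∈ M.endType β := by simpa [endType] using ha
    rw [h] at this
    simpa [endType] using this
  · have : (q, false) ∈ M.endType β := by simpa [endType] using ha
    rw [h] at this
    simpa [endType] using this

theorem AcceptsFrom.append_of_endType_eq {β β' : List Γ} (h : M.endType β = M.endType β')
    {q : Q} {r w : List (TSym α)} {ζ : List Γ} (hr : w ++ r = [TSym.rend])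
    (ha : M.AcceptsFrom ⟨q, r, ζ ++ β⟩) : M.AcceptsFrom ⟨q, r, ζ ++ β'⟩ := by
  obtain ⟨c', hc', ha⟩ := ha
  rcases hc'.untouched_or rfl with ⟨ζ', -, h₂⟩ | ⟨s, r', h₁, h₂⟩
  · exact ⟨⟨c'.st, c'.inp, ζ' ++ β'⟩, by simpa using h₂.append [] β', ha⟩
  · obtain ⟨v, hv, -⟩ := h₁.exists_inp
    have hv : r = v ++ r' := hv
    refine Reaches.acceptsFrom (by simpa using h₁.append [] β')
      (acceptsFrom_of_endType_eq (w := w ++ v) h (by simp [← hr, hv]) ⟨c', h₂, ha⟩)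

theorem endType_append {β β' : List Γ} (h : M.endType β = M.endType β') (ζ : List Γ) :
    M.endType (ζ ++ β) = M.endType (ζ ++ β') := by
  have aux : ∀ {β β' : List Γ}, M.endType β = M.endType β' →
      M.endType (ζ ++ β) ⊆ M.endType (ζ ++ β') := by
    rintro β β' h ⟨q, b⟩ hq
    cases b
    · exact AcceptsFrom.append_of_endType_eq (w := [TSym.rend]) h (by simp) hq
    · exact AcceptsFrom.append_of_endType_eq (w := []) h (by simp) hq
  exact (aux h).antisymm (aux h.symm)

theorem endType_iterate {W β : List Γ} (h : M.endType (W ++ β) = M.endType β) (i : ℕ) :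
    M.endType ((W ++ ·)^[i] β) = M.endType β := by
  induction i with
  | zero => rfl
  | succ i ih => rw [Function.iterate_succ_apply', endType_append ih, h]

/-! ### Machines whose language is contained in `Lkn d` -/

/-- The word `aⁿ bᵐ`. -/
def word (n m : ℕ) : List Bool := List.replicate n false ++ List.replicate m true

/-- The tape segment `aⁿ`. -/
def aTape (n : ℕ) : List (TSym Bool) := List.replicate n (.ch false)

/-- The tape segment `bⁿ`. -/
def bTape (n : ℕ) : List (TSym Bool) := List.replicate n (.ch true)

theorem aTape_add (m n : ℕ) : aTape (m + n) = aTape m ++ aTape n := List.replicate_add ..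

theorem bTape_add (m n : ℕ) : bTape (m + n) = bTape m ++ bTape n := List.replicate_add ..

theorem length_aTape (n : ℕ) : (aTape n).length = n := List.length_replicate

theorem length_bTape (n : ℕ) : (bTape n).length = n := List.length_replicate

theorem tape_word (n m : ℕ) :
    tape (word n m) = .lend :: (aTape n ++ (bTape m ++ [.rend])) := by
  simp [tape, word, aTape, bTape]

theorem word_mem_Lkn {d n m : ℕ} : word n m ∈ Lkn d ↔ ∃ k, 1 ≤ k ∧ k ≤ d ∧ m = k * n := by
  constructor
  · rintro ⟨n', k, h₁, h₂, h⟩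
    have ha := congrArg (List.count false) h
    have hb := congrArg (List.count true) h
    simp [word, List.count_replicate] at ha hb
    subst ha
    exact ⟨k, h₁, h₂, hb⟩
  · rintro ⟨k, h₁, h₂, rfl⟩
    exact ⟨n, k, h₁, h₂, rfl⟩

theorem not_forall_word_mem_of_unbounded_right {d n m : ℕ}
    (h : ∀ j, word n (m + j) ∈ Lkn d) : False := by
  obtain ⟨k, -, hk, h⟩ := word_mem_Lkn.1 (h (d * n + 1))
  have := Nat.mul_le_mul_right n hk
  omega

theorem not_forall_word_mem_of_unbounded_left {d n m p : ℕ} (hn : 0 < n) (hp : 0 < p)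
    (h : ∀ i, word (n + p * i) m ∈ Lkn d) : False := by
  obtain ⟨k, hk, -, h₀⟩ := word_mem_Lkn.1 (h 0)
  obtain ⟨k', hk', -, h₁⟩ := word_mem_Lkn.1 (h m)
  have h₂ : 1 * (n + p * m) ≤ k' * (n + p * m) := Nat.mul_le_mul_right _ hk'
  have h₃ : 1 * m ≤ p * m := Nat.mul_le_mul_right _ hp
  omega

section

variable {M : DPDA Q Bool Γ} {d : ℕ}

/-- Some configuration `(q, γ)` occurs in the computation once `¢ aⁿ` has been read. -/
def After (M : DPDA Q Bool Γ) (n : ℕ) (q : Q) (γ : List Γ) : Prop :=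
  M.Reaches ⟨M.q0, .lend :: aTape n, [M.Z0]⟩ ⟨q, [], γ⟩

theorem After.reaches_init {n : ℕ} {q : Q} {γ : List Γ} (h : M.After n q γ) (u m : ℕ) :
    M.Reaches (M.init (word (n + u) m)) ⟨q, aTape u ++ (bTape m ++ [.rend]), γ⟩ := by
  simpa [init, tape_word, aTape_add] using h.append (aTape u ++ (bTape m ++ [.rend])) []

theorem After.add {i j : ℕ} {q q' : Q} {γ γ' : List Γ} (h : M.After i q γ)
    (h' : M.Reaches ⟨q, aTape j, γ⟩ ⟨q', [], γ'⟩) : M.After (i + j) q' γ' :=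
  .trans (by simpa [aTape_add] using h.append (aTape j) []) h'

theorem After.reaches {i j : ℕ} {q q' : Q} {γ γ' : List Γ} (h : M.After i q γ)
    (h' : M.After (i + j) q' γ') (hj : 0 < j) : M.Reaches ⟨q, aTape j, γ⟩ ⟨q', [], γ'⟩ := by
  have h₁ : M.Reaches ⟨M.q0, .lend :: aTape (i + j), [M.Z0]⟩ ⟨q, aTape j, γ⟩ := by
    simpa [aTape_add] using h.append (aTape j) []
  refine (h₁.total h').resolve_right fun h₂ => ?_
  obtain ⟨w, hw, -⟩ := h₂.exists_inp
  have := congrArg List.length hw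
  simp [length_aTape] at this
  omega

/-- A machine cannot accept a word of `Lkn d` without reading the right endmarker. -/
theorem exists_reaches_of_mem_lang (hM : M.lang ⊆ Lkn d) {n m : ℕ} (h : word n m ∈ M.lang) :
    ∃ q γ, M.Reaches (M.init (word n m)) ⟨q, [], γ⟩ ∧ q ∈ M.Acc := by
  obtain ⟨⟨q, r, γ⟩, hc, ha⟩ := mem_lang_iff.1 h
  rcases List.eq_nil_or_concat' r with rfl | ⟨r, t, rfl⟩
  · exact ⟨q, γ, hc, ha⟩
  exfalso
  obtain ⟨w, hw, hr⟩ := hc.exists_inp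
  have hw : .lend :: (aTape n ++ (bTape m ++ [.rend])) = w ++ (r ++ [t]) := by
    rw [← hw, ← tape_word]; rfl
  have hw' : .lend :: (aTape n ++ bTape m) = w ++ r := by
    exact List.append_inj_left' (t₁ := [.rend]) (t₂ := [t]) (by simpa using hw) rfl
  refine not_forall_word_mem_of_unbounded_right (n := n) (m := m) fun j => hM (mem_lang_iff.2 ?_)
  have hj : .lend :: (aTape n ++ (bTape (m + j) ++ [.rend])) =
      w ++ (r ++ (bTape j ++ [.rend])) := by
    rw [← List.append_assoc w, ← hw', bTape_add]
    simp
  refine ⟨⟨q, r ++ (bTape j ++ [.rend]), γ ++ []⟩, ?_, ha⟩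
  rw [init, tape_word, hj]
  exact hr.append _ []

theorem exists_after (hM : M.lang ⊆ Lkn d) (hinf : ∀ N, ∃ n ≥ N, ∃ m, word n m ∈ M.lang) (n : ℕ) :
    ∃ q γ, M.After n q γ := by
  obtain ⟨n', hn, m, h⟩ := hinf n
  obtain ⟨q, γ, h, -⟩ := exists_reaches_of_mem_lang hM h
  obtain ⟨j, rfl⟩ := Nat.exists_eq_add_of_le hn
  exact h.exists_append (u := .lend :: aTape n) (v := aTape j ++ (bTape m ++ [.rend]))
    (by simp [init, tape_word, aTape_add]) (by simp)

/-- The periodic behaviour of a machine on a long block of `a`s: from some time on the stack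
symbols `β` are never touched, and reading `aᵖ` inserts the block `W` above them. -/
structure IsPump (M : DPDA Q Bool Γ) (t p : ℕ) (q : Q) (X : Γ) (W β : List Γ) : Prop where
  pos : 0 < p
  after : M.After t q (X :: β)
  reaches : M.Reaches ⟨q, aTape p, [X]⟩ ⟨q, [], X :: W⟩
  endType_eq : M.endType (W ++ β) = M.endType β
  length_lt : ∀ i ≥ t, ∀ q' γ', M.After i q' γ' → β.length < γ'.length

theorem exists_isPump [Finite Q] [Finite Γ] (h : ∀ n, ∃ q γ, M.After n q γ) :
    ∃ t p q X W β, M.IsPump t p q X W β := by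
  have hmin : ∀ n, ∃ i ≥ n, ∃ q X β, M.After i q (X :: β) ∧
      ∀ i' ≥ n, ∀ q' γ', M.After i' q' γ' → β.length < γ'.length := by
    intro n
    have hne : ∃ l, ∃ i ≥ n, ∃ q γ, M.After i q γ ∧ γ.length = l := by
      obtain ⟨q, γ, h⟩ := h n
      exact ⟨_, n, le_rfl, q, γ, h, rfl⟩
    classical
    obtain ⟨i, hi, q, γ, hγ, hl⟩ := Nat.find_spec hne
    rcases γ with _ | ⟨X, β⟩
    · obtain ⟨q', γ', h'⟩ := h (i + 1)
      simpa [aTape] using (hγ.reaches h' one_pos).eq_of_step_eq_none (step_nil _ _)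
    · refine ⟨i, hi, q, X, β, hγ, fun i' hi' q' γ' h' => ?_⟩
      have := Nat.find_min' hne ⟨i', hi', q', γ', h', rfl⟩
      rw [← hl] at this
      exact this
  choose i hi q X β hβ hlt using hmin
  obtain ⟨⟨q₀, X₀, T⟩, hf⟩ :=
    Finite.exists_infinite_fiber fun n => (q n, X n, M.endType (β n))
  rw [Set.infinite_coe_iff] at hf
  obtain ⟨n, hn⟩ := hf.nonempty
  obtain ⟨n', hn', hnn⟩ := hf.exists_gt (i n)
  simp only [Set.mem_preimage, Set.mem_singleton_iff, Prod.mk.injEq] at hn hn'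
  obtain ⟨rfl, rfl, rfl⟩ := hn
  obtain ⟨hq, hX, hT⟩ := hn'
  have hii : i n < i n' := hnn.trans_le (hi n')
  obtain ⟨p, hp⟩ := Nat.exists_eq_add_of_lt hii
  have hβ' := hβ n'
  rw [hq, hX, hp, add_assoc] at hβ'
  have hr := (hβ n).reaches hβ' (Nat.succ_pos p)
  rcases hr.untouched_or (ζ := [X n]) rfl with ⟨ζ, h₁, h₂⟩ | ⟨s, r, h₁, h₂⟩
  · rcases ζ with _ | ⟨Y, W⟩
    · have := hlt n (i n + (p + 1)) ((hi n).trans (Nat.le_add_right ..)) _ _ hβ'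
      exact absurd (congrArg List.length h₁) this.ne'
    · simp only [List.cons_append, List.cons.injEq] at h₁
      obtain ⟨rfl, h₁⟩ := h₁
      exact ⟨i n, p + 1, q n, X n, W, β n, Nat.succ_pos p, hβ n, h₂, h₁ ▸ hT,
        fun j hj => hlt n j ((hi n).trans hj)⟩
  · exfalso
    obtain ⟨w, hw, h₃⟩ := h₁.exists_inp
    obtain ⟨v, hv, rfl⟩ : ∃ v ≤ p + 1, w = aTape v := by
      obtain ⟨h, h', -⟩ := List.append_eq_replicate_iff.1 hw.symm
      exact ⟨w.length, by omega, h'⟩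
    have h₄ := (hβ n).add (j := v) (by simpa using h₃.append [] (β n))
    exact lt_irrefl _ (hlt n _ ((hi n).trans (Nat.le_add_right ..)) _ _ h₄)

namespace IsPump

variable {t p : ℕ} {q : Q} {X : Γ} {W β : List Γ}

theorem after_iterate (h : M.IsPump t p q X W β) (i : ℕ) :
    M.After (t + p * i) q (X :: (W ++ ·)^[i] β) := by
  induction i with
  | zero => exact h.after
  | succ i ih =>
    rw [Nat.mul_succ, ← add_assoc, Function.iterate_succ_apply']
    exact ih.add (by simpa using h.reaches.append [] ((W ++ ·)^[i] β))

theorem word_mem_lang (h : M.IsPump t p q X W β) {u e x : ℕ} {s : Q}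
    (hs : M.Reaches ⟨q, aTape u ++ bTape e, [X]⟩ ⟨s, [], []⟩)
    (hx : M.AcceptsFrom ⟨s, bTape x ++ [.rend], β⟩) : word (t + u) (e + x) ∈ M.lang := by
  refine mem_lang_iff.2 ((h.after.reaches_init u (e + x)).acceptsFrom (Reaches.acceptsFrom ?_ hx))
  simpa [bTape_add] using hs.append (bTape x ++ [.rend]) β

/-- After `aⁿ` with `n` large, no word is accepted before the stack is popped down to `β`. -/
theorem exists_reaches (h : M.IsPump t p q X W β) (hM : M.lang ⊆ Lkn d) {u m : ℕ} (hu : 0 < u)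
    (hm : word (t + u) m ∈ M.lang) :
    ∃ e x s, m = e + x ∧ M.Reaches ⟨q, aTape u ++ bTape e, [X]⟩ ⟨s, [], []⟩ ∧
      M.AcceptsFrom ⟨s, bTape x ++ [.rend], β⟩ := by
  have hpump (H : ∀ i, M.AcceptsFrom
      ⟨q, aTape u ++ (bTape m ++ [.rend]), X :: (W ++ ·)^[i] β⟩) : False := by
    refine not_forall_word_mem_of_unbounded_left (n := t + u) (m := m) (d := d)
      (by omega) h.pos fun i => hM (mem_lang_iff.2 ?_)
    rw [add_right_comm]
    exact ((h.after_iterate i).reaches_init u m).acceptsFrom (H i)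
  obtain ⟨q', γ', hc, ha⟩ := exists_reaches_of_mem_lang hM hm
  have hr : M.Reaches ⟨q, aTape u ++ (bTape m ++ [.rend]), X :: β⟩ ⟨q', [], γ'⟩ := by
    refine ((h.after.reaches_init u m).total hc).resolve_right fun h' => ?_
    obtain ⟨w, hw, -⟩ := h'.exists_inp
    simp at hw
  rcases hr.untouched_or (ζ := [X]) rfl with ⟨ζ, -, h₂⟩ | ⟨s, r, h₁, h₂⟩
  · exact (hpump fun i => ⟨_, by simpa using h₂.append [] ((W ++ ·)^[i] β), ha⟩).elim
  obtain ⟨w, hw, h₃⟩ := h₁.exists_inp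
  rcases List.append_eq_append_iff.1 hw with ⟨w', rfl, hw'⟩ | ⟨v', hv, -⟩
  · rcases List.append_eq_append_iff.1 hw' with ⟨v, rfl, hv⟩ | ⟨v, hv, rfl⟩
    · refine (hpump fun i => Reaches.acceptsFrom (c' := ⟨s, r, (W ++ ·)^[i] β⟩)
        (by simpa using h₁.append [] ((W ++ ·)^[i] β)) ?_).elim
      exact acceptsFrom_of_endType_eq (endType_iterate h.endType_eq i).symm hv.symm ⟨_, h₂, ha⟩
    · obtain ⟨hl, hw', hv⟩ := List.append_eq_replicate_iff.1 hv.symm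
      refine ⟨w'.length, v.length, s, hl.symm, ?_, ?_⟩
      · rw [hw'] at h₃
        simpa [bTape] using h₃
      · rw [hv] at h₂
        exact ⟨_, by simpa [bTape] using h₂, ha⟩
  · obtain ⟨hl, hw', -⟩ := List.append_eq_replicate_iff.1 hv.symm
    rw [hw'] at h₃
    have h₄ := h.after.add (j := w.length) (by simpa [aTape] using h₃.append [] β)
    exact (lt_irrefl _ (h.length_lt _ (Nat.le_add_right ..) _ _ h₄)).elim

theorem reaches_unique {u e₁ e₂ : ℕ} {s₁ s₂ : Q}
    (h₁ : M.Reaches ⟨q, aTape u ++ bTape e₁, [X]⟩ ⟨s₁, [], []⟩)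
    (h₂ : M.Reaches ⟨q, aTape u ++ bTape e₂, [X]⟩ ⟨s₂, [], []⟩) : e₁ = e₂ ∧ s₁ = s₂ := by
  wlog h : e₁ ≤ e₂ generalizing e₁ e₂ s₁ s₂
  · exact (this h₂ h₁ (le_of_not_ge h)).imp .symm .symm
  obtain ⟨j, rfl⟩ := Nat.exists_eq_add_of_le h
  have h₃ : M.Reaches ⟨q, aTape u ++ bTape (e₁ + j), [X]⟩ ⟨s₁, bTape j, []⟩ := by
    simpa [bTape_add] using h₁.append (bTape j) []
  have h₄ := h₃.unique h₂ (step_nil _ _) (step_nil _ _)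
  simp only [Cfg.mk.injEq, and_true] at h₄
  have := length_bTape j
  rw [h₄.2] at this
  exact ⟨by simpa using this.symm, h₄.1⟩

end IsPump

/-- A machine whose language is contained in `Lkn d` accepts at most one word `aⁿ bᵐ` for each
large `n`. -/
theorem exists_forall_word_unique [Finite Q] [Finite Γ] (hM : M.lang ⊆ Lkn d) :
    ∃ N, ∀ n ≥ N, ∀ m₁ m₂, word n m₁ ∈ M.lang → word n m₂ ∈ M.lang → m₁ = m₂ := by
  by_cases hinf : ∀ N, ∃ n ≥ N, ∃ m, word n m ∈ M.lang
  swap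
  · push Not at hinf
    obtain ⟨N, hN⟩ := hinf
    exact ⟨N, fun n hn m _ h => absurd h (hN n hn m)⟩
  obtain ⟨t, p, q, X, W, β, h⟩ := exists_isPump (exists_after hM hinf)
  have hD : ∀ s : Q, ∃ D, (∃ x y, x < y ∧ M.AcceptsFrom ⟨s, bTape x ++ [.rend], β⟩ ∧
      M.AcceptsFrom ⟨s, bTape y ++ [.rend], β⟩) → ∃ x y, x < y ∧ y ≤ D ∧
        M.AcceptsFrom ⟨s, bTape x ++ [.rend], β⟩ ∧ M.AcceptsFrom ⟨s, bTape y ++ [.rend], β⟩ := by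
    intro s
    by_cases hs : ∃ x y, x < y ∧ M.AcceptsFrom ⟨s, bTape x ++ [.rend], β⟩ ∧
      M.AcceptsFrom ⟨s, bTape y ++ [.rend], β⟩
    · obtain ⟨x, y, hxy, hx, hy⟩ := hs
      exact ⟨y, fun _ => ⟨x, y, hxy, le_rfl, hx, hy⟩⟩
    · exact ⟨0, fun h => absurd h hs⟩
  choose D hD using hD
  obtain ⟨B, hB⟩ := (Set.finite_range D).bddAbove
  refine ⟨t + B + 1, fun n hn m₁ m₂ hm₁ hm₂ => ?_⟩
  obtain ⟨u, rfl⟩ := Nat.exists_eq_add_of_le (show t ≤ n by omega)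
  obtain ⟨e, x₁, s, rfl, hs, hx₁⟩ := h.exists_reaches hM (by omega) hm₁
  obtain ⟨e', x₂, s', rfl, hs', hx₂⟩ := h.exists_reaches hM (by omega) hm₂
  obtain ⟨rfl, rfl⟩ := IsPump.reaches_unique hs hs'
  by_contra hne
  obtain ⟨x, y, hxy, hyD, hx, hy⟩ : ∃ x y, x < y ∧ y ≤ D s ∧
      M.AcceptsFrom ⟨s, bTape x ++ [.rend], β⟩ ∧ M.AcceptsFrom ⟨s, bTape y ++ [.rend], β⟩ := by
    rcases lt_trichotomy x₁ x₂ with hlt | rfl | hlt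
    · exact hD s ⟨x₁, x₂, hlt, hx₁, hx₂⟩
    · exact absurd rfl hne
    · exact hD s ⟨x₂, x₁, hlt, hx₂, hx₁⟩
  have hyB : y ≤ B := hyD.trans (hB ⟨s, rfl⟩)
  obtain ⟨k, -, -, hk⟩ := word_mem_Lkn.1 (hM (h.word_mem_lang hs hx))
  obtain ⟨l, -, -, hl⟩ := word_mem_Lkn.1 (hM (h.word_mem_lang hs hy))
  have hdvd : t + u ∣ y - x := by
    rw [show y - x = (e + y) - (e + x) by omega]
    exact Nat.dvd_sub ⟨l, by rw [hl, mul_comm]⟩ ⟨k, by rw [hk, mul_comm]⟩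
  have := Nat.le_of_dvd (by omega) hdvd
  omega

end

end DPDA

theorem not_DCFLUnion_pred_Lkn {d : ℕ} (hd : 1 ≤ d) : ¬ DCFLUnion (d - 1) (Lkn d) := by
  rintro ⟨f, hf, hL⟩
  have hN : ∀ i, ∃ N, ∀ n ≥ N, ∀ m₁ m₂,
      DPDA.word n m₁ ∈ f i → DPDA.word n m₂ ∈ f i → m₁ = m₂ := by
    intro i
    obtain ⟨Q, Γ, _, _, M, -, -, hM⟩ := hf i
    rw [hM]
    refine DPDA.exists_forall_word_unique (d := d) ?_
    rw [← hM, hL]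
    exact Set.subset_iUnion f i
  choose N hN using hN
  obtain ⟨B, hB⟩ := (Set.finite_range N).bddAbove
  have hmem : ∀ k : Fin d, ∃ i, DPDA.word (B + 1) ((k + 1) * (B + 1)) ∈ f i := fun k =>
    Set.mem_iUnion.1 (hL ▸ DPDA.word_mem_Lkn.2 ⟨k + 1, by omega, by omega, rfl⟩)
  choose g hg using hmem
  obtain ⟨k, l, hkl, h⟩ := Fintype.exists_ne_map_eq_of_card_lt g (by simp; omega)
  have h₁ := hN (g k) (B + 1) ((hB ⟨_, rfl⟩).trans (Nat.le_succ B)) _ _ (hg k) (h ▸ hg l)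
  have h₂ := Nat.eq_of_mul_eq_mul_right (Nat.succ_pos B) h₁
  exact hkl (Fin.ext (by omega))

/-! ### A machine for `{aⁿ b^{kn}}` -/

namespace DPDA

section

variable {Q α Γ : Type} {M : DPDA Q α Γ}

/-- The computation from `c` halts, and accepts exactly when `P` holds. -/
def Decides (M : DPDA Q α Γ) (c : Cfg Q α Γ) (P : Prop) : Prop :=
  ∃ c', M.Reaches c c' ∧ ((P ∧ c'.st ∈ M.Acc) ∨ (¬ P ∧ c'.st ∈ M.Rej))

theorem Decides.head {c c' : Cfg Q α Γ} {P : Prop} (h : M.step c = some c')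
    (h' : M.Decides c' P) : M.Decides c P :=
  let ⟨d, hd, hP⟩ := h'
  ⟨d, hd.head h, hP⟩

theorem Valid.step_eq_none (hM : M.Valid) {c : Cfg Q α Γ} (hc : M.IsHalting c.st) :
    M.step c = none := by
  obtain ⟨q, u, _ | ⟨a, s⟩⟩ := c
  · rfl
  · cases u <;> simp [step, hM.2.1 q hc]

theorem Decides.acceptsFrom_iff (hM : M.Valid) {c : Cfg Q α Γ} {P : Prop} (h : M.Decides c P) :
    M.AcceptsFrom c ↔ P := by
  obtain ⟨d, hd, ⟨hP, ha⟩ | ⟨hP, hr⟩⟩ := h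
  · exact iff_of_true ⟨d, hd, ha⟩ hP
  · refine iff_of_false (fun ⟨e, he, ha⟩ => ?_) hP
    obtain rfl := hd.unique he (hM.step_eq_none (.inr hr)) (hM.step_eq_none (.inl ha))
    exact hM.1 _ ha hr

theorem isDCFL_of_decides [Fintype Q] [Fintype Γ] (hM : M.Valid) {L : Set (List α)}
    (h : ∀ x, M.Decides (M.init x) (x ∈ L)) : IsDCFL L := by
  refine ⟨Q, Γ, ‹_›, ‹_›, M, hM, fun x => ?_, ?_⟩
  · obtain ⟨c, ⟨n, hn⟩, hc⟩ := h x
    exact ⟨n, c, hn, hc.imp And.right And.right⟩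
  · ext x
    rw [mem_lang_iff, (h x).acceptsFrom_iff hM]

end

/-- The states of `ratioDPDA`. -/
inductive RatioState : Type
  | start | readA | readB | acc | rej
  deriving DecidableEq

open RatioState

instance : Fintype RatioState where
  elems := {start, readA, readB, acc, rej}
  complete q := by cases q <;> simp

/-- The transitions of `ratioDPDA`. -/
def ratioδ (k : ℕ) : RatioState → Option (TSym Bool) → Bool → Option (RatioState × List Bool)
  | acc, _, _ => none
  | rej, _, _ => none
  | start, some .lend, a => some (readA, [a])
  | readA, some (.ch false), a => some (readA, List.replicate k true ++ [a])
  | readA, some (.ch true), true => some (readB, [])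
  | readB, some (.ch true), true => some (readB, [])
  | readA, some .rend, false => some (acc, [false])
  | readB, some .rend, false => some (acc, [false])
  | _, some _, a => some (rej, [a])
  | _, none, _ => none

/-- A machine for `{aⁿ b^{kn}}`: it pushes `k` symbols for each `a`, and pops one for each `b`.
The bottom marker is `false`. -/
def ratioDPDA (k : ℕ) : DPDA RatioState Bool Bool where
  δ := ratioδ k
  q0 := start
  Z0 := false
  Acc := {acc}
  Rej := {rej}

variable {k : ℕ}

theorem ratioDPDA_valid : (ratioDPDA k).Valid := by
  refine ⟨?_, ?_, ?_, ?_⟩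
  · rintro q rfl
    simp [ratioDPDA]
  · rintro q (rfl | rfl) σ a <;> rfl
  · rintro (_ | _ | _ | _ | _) hq (_ | _ | _ | _) (_ | _) <;>
      simp_all [ratioDPDA, ratioδ, IsHalting]
  · rintro (_ | _ | _ | _ | _) (_ | _ | _ | _ | _) p w h rfl <;> simp_all [ratioDPDA, ratioδ]

theorem ratioDPDA_decides_acc {c : Cfg RatioState Bool Bool} {P : Prop}
    (h : (ratioDPDA k).step c = some ⟨acc, [], c.stk⟩) (hP : P) : (ratioDPDA k).Decides c P :=
  ⟨_, .head h (.refl _), .inl ⟨hP, rfl⟩⟩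

theorem ratioDPDA_decides_rej {c : Cfg RatioState Bool Bool} {P : Prop} {u : List (TSym Bool)}
    (h : (ratioDPDA k).step c = some ⟨rej, u, c.stk⟩) (hP : ¬ P) : (ratioDPDA k).Decides c P :=
  ⟨_, .head h (.refl _), .inr ⟨hP, rfl⟩⟩

theorem ratioDPDA_readB (x : List Bool) (j : ℕ) :
    (ratioDPDA k).Decides ⟨readB, x.map .ch ++ [.rend], List.replicate j true ++ [false]⟩
      (x = List.replicate j true) := by
  induction x generalizing j with
  | nil =>
    cases j with
    | zero => exact ratioDPDA_decides_acc rfl rfl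
    | succ j => exact ratioDPDA_decides_rej rfl (by simp [List.replicate_succ])
  | cons b x ih =>
    cases j with
    | zero => cases b <;> exact ratioDPDA_decides_rej rfl (by simp)
    | succ j =>
      cases b with
      | false => exact ratioDPDA_decides_rej rfl (by simp [List.replicate_succ])
      | true =>
        refine Decides.head (c' := ⟨readB, _, _⟩) rfl ?_
        simpa [List.replicate_succ] using ih j

theorem ratioDPDA_readA (x : List Bool) (j : ℕ) :
    (ratioDPDA k).Decides ⟨readA, x.map .ch ++ [.rend], List.replicate j true ++ [false]⟩
      (∃ n, x = List.replicate n false ++ List.replicate (k * n + j) true) := by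
  induction x generalizing j with
  | nil =>
    cases j with
    | zero => exact ratioDPDA_decides_acc rfl ⟨0, by simp⟩
    | succ j => exact ratioDPDA_decides_rej rfl (by simp)
  | cons b x ih =>
    cases b with
    | false =>
      have hstep : (ratioDPDA k).step
          ⟨readA, (false :: x).map .ch ++ [.rend], List.replicate j true ++ [false]⟩ =
          some ⟨readA, x.map .ch ++ [.rend], List.replicate (k + j) true ++ [false]⟩ := by
        cases j with
        | zero => simp [step, ratioDPDA, ratioδ]
        | succ j => simp [step, ratioDPDA, ratioδ, List.replicate_succ, List.replicate_add]
      refine Decides.head hstep ?_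
      convert ih (k + j) using 1
      constructor
      · rintro ⟨_ | n, hn⟩
        · cases j <;> simp [List.replicate_succ] at hn
        · refine ⟨n, ?_⟩
          rw [List.replicate_succ, List.cons_append, List.cons.injEq] at hn
          rw [hn.2, Nat.mul_succ, add_assoc]
      · rintro ⟨n, rfl⟩
        refine ⟨n + 1, ?_⟩
        rw [Nat.mul_succ, add_assoc]
        rfl
    | true =>
      cases j with
      | zero =>
        refine ratioDPDA_decides_rej rfl ?_
        rintro ⟨_ | n, hn⟩ <;> simp [List.replicate_succ] at hn
      | succ j =>
        refine Decides.head (c' := ⟨readB, x.map .ch ++ [.rend],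
          List.replicate j true ++ [false]⟩) rfl ?_
        convert ratioDPDA_readB x j using 1
        constructor
        · rintro ⟨_ | n, hn⟩
          · simpa [List.replicate_succ] using hn
          · simp [List.replicate_succ] at hn
        · rintro rfl
          exact ⟨0, by simp [List.replicate_succ]⟩

theorem isDCFL_ratio (k : ℕ) :
    IsDCFL {x | ∃ n, x = List.replicate n false ++ List.replicate (k * n) true} :=
  isDCFL_of_decides ratioDPDA_valid fun x =>
    Decides.head (c' := ⟨readA, x.map .ch ++ [.rend], [false]⟩) rfl (ratioDPDA_readA x 0)

end DPDA

theorem DCFLUnion_Lkn (d : ℕ) : DCFLUnion d (Lkn d) := by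
  refine ⟨fun i => {x | ∃ n, x = List.replicate n false ++ List.replicate ((i + 1) * n) true},
    fun i => DPDA.isDCFL_ratio _, ?_⟩
  ext x
  simp only [Lkn, Set.mem_ofPred_eq, Set.mem_iUnion]
  constructor
  · rintro ⟨n, k, h₁, h₂, rfl⟩
    exact ⟨⟨k - 1, by omega⟩, n, by simp [Nat.sub_add_cancel h₁]⟩
  · rintro ⟨i, n, rfl⟩
    exact ⟨n, i + 1, by omega, by omega, rfl⟩

/-- `L_(d)` belongs to `DCFL[d]` but not to `DCFL[d−1]`. -/
theorem Lkn_in_DCFLUnion_d_not_in_DCFLUnion_pred (d : ℕ) (hd : 2 ≤ d) :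
    DCFLUnion d (Lkn d) ∧ ¬ DCFLUnion (d - 1) (Lkn d) := by
  exact ⟨DCFLUnion_Lkn d, not_DCFLUnion_pred_Lkn (by omega)⟩

end DCFLFormal
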